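/- Let d be an even positive integer and let ε : {0,…,d−1} → {−1,1} be a sign pattern with ε(0) = −1. Then the set G_{d,(1,1)}(ε) of coefficient vectors (a_0,…,a_{d−1}) ∈ ℝ^d such that the monic polynomial Q = x^d + a_{d−1}x^{d−1} + ⋯ + a_0 has sign pattern ε and has exactly two real roots, both simple (necessarily one positive and one negative), is contractible. -/

import Mathlib

open Polynomial

/-- The monic polynomial `x^d + a_{d-1} x^{d-1} + ⋯ + a_1 x + a_0`
associated to a coefficient vector `a ∈ ℝ^d`. -/
noncomputable def Qpoly (d : ℕ) (a : Fin d → ℝ) : Polynomial ℝ :=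
  X ^ d + ∑ j : Fin d, C (a j) * X ^ (j : ℕ)

/-- `Qpoly d a` has exactly two real roots, both simple, namely `r₁` and `r₂`. -/
def TwoSimpleRoots (d : ℕ) (a : Fin d → ℝ) (r₁ r₂ : ℝ) : Prop :=
  r₁ ≠ r₂ ∧ (Qpoly d a).eval r₁ = 0 ∧ (Qpoly d a).eval r₂ = 0 ∧
    (Polynomial.derivative (Qpoly d a)).eval r₁ ≠ 0 ∧
    (Polynomial.derivative (Qpoly d a)).eval r₂ ≠ 0 ∧
    ∀ x : ℝ, (Qpoly d a).eval x = 0 → x = r₁ ∨ x = r₂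

open Topology Filter

/-- A set that projects continuously onto a convex base, with convex fibres admitting continuous
local selections, is contractible. -/
theorem contractibleSpace_of_convex_fibers {E F : Type*}
    [NormedAddCommGroup E] [NormedSpace ℝ E] [NormedAddCommGroup F] [NormedSpace ℝ F]
    {G : Set E} {B : Set F} (fib : F → Set E) (π : E → F)
    (hB : Convex ℝ B) (hBne : B.Nonempty) (hπ : ContinuousOn π G) (hπB : Set.MapsTo π G B)
    (hmem : ∀ a ∈ G, a ∈ fib (π a)) (hfib : ∀ b ∈ B, fib b ⊆ G)
    (hπfib : ∀ b ∈ B, ∀ a ∈ fib b, π a = b) (hconv : ∀ b, Convex ℝ (fib b))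
    (hloc : ∀ b ∈ B, ∃ g : F → E, Continuous g ∧ ∀ᶠ c in 𝓝 b, c ∈ B → g c ∈ fib c) :
    ContractibleSpace G := by
  obtain ⟨σ, hσ⟩ := exists_continuous_forall_mem_convex_of_local (X := B)
    (t := fun b => fib b) (fun b => hconv b) (by
      rintro ⟨b, hb⟩
      obtain ⟨g, hg, hgm⟩ := hloc b hb
      refine ⟨{c : B | (c : F) ∈ B → g c ∈ fib c}, ?_, fun c => g c, by fun_prop, ?_⟩
      · have hval : Tendsto (Subtype.val : B → F) (𝓝 ⟨b, hb⟩) (𝓝 b) :=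
          continuous_subtype_val.tendsto _
        exact hval.eventually hgm
      · exact fun c hc => hc c.2)
  let p : C(G, B) := ⟨fun a => ⟨π a, hπB a.2⟩, by
    exact (continuousOn_iff_continuous_domRestrict.1 hπ).subtype_mk _⟩
  let s : C(B, G) := ⟨fun b => ⟨σ b, hfib b b.2 (hσ b)⟩, by
    exact σ.continuous.subtype_mk _⟩
  have hps : p.comp s = ContinuousMap.id B := by
    ext b
    exact hπfib b b.2 _ (hσ b)
  have := hB.contractibleSpace hBne
  refine ContinuousMap.HomotopyEquiv.contractibleSpace (Y := B) ⟨p, s, ⟨⟨⟨fun x =>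
    ⟨(1 - (x.1 : ℝ)) • σ (p x.2) + (x.1 : ℝ) • (x.2 : E), ?_⟩, ?_⟩, ?_, ?_⟩⟩, ?_⟩
  · refine hfib _ (hπB x.2.2) (hconv _ (hσ (p x.2)) (hmem _ x.2.2) ?_ x.1.2.1 (by ring))
    linarith [x.1.2.2]
  · fun_prop
  · intro a
    ext1
    simp [s]
  · intro a
    ext1
    simp
  · rw [hps]

theorem eval_Qpoly (d : ℕ) (a : Fin d → ℝ) (x : ℝ) :
    (Qpoly d a).eval x = x ^ d + ∑ j, a j * x ^ (j : ℕ) := by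
  simp [Qpoly, eval_finsetSum]

theorem monic_Qpoly (d : ℕ) (a : Fin d → ℝ) : (Qpoly d a).Monic :=
  monic_X_pow_add (degree_sum_fin_lt a)

theorem natDegree_Qpoly (d : ℕ) (a : Fin d → ℝ) : (Qpoly d a).natDegree = d := by
  rw [Qpoly, natDegree_add_eq_left_of_degree_lt] <;> simp [degree_sum_fin_lt a]

theorem coeff_Qpoly (d : ℕ) (a : Fin d → ℝ) (j : Fin d) : (Qpoly d a).coeff j = a j := by
  simp [Qpoly, coeff_X_pow, j.2.ne, Fin.val_inj]

theorem Qpoly_coeff {d : ℕ} {P : ℝ[X]} (hP : P.Monic) (hd : P.natDegree = d) :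
    Qpoly d (fun j => P.coeff j) = P := by
  conv_rhs => rw [hP.as_sum, hd]
  rw [Qpoly, Fin.sum_univ_eq_sum_range (fun j => C (P.coeff j) * X ^ j)]

/-- Coefficient vectors with signs `ε` whose polynomial is
`(X - b.2) * (X + b.1)` times an everywhere positive polynomial. -/
def rootFiber (d : ℕ) (ε : Fin d → ℝ) (b : ℝ × ℝ) : Set (Fin d → ℝ) :=
  {a | (∀ j, 0 < ε j * a j) ∧
    ∃ W : ℝ[X], Qpoly d a = (X - C b.2) * (X + C b.1) * W ∧ ∀ x, 0 < W.eval x}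

theorem Qpoly_combo (d : ℕ) (a a' : Fin d → ℝ) {u v : ℝ} (huv : u + v = 1) :
    Qpoly d (u • a + v • a') = C u * Qpoly d a + C v * Qpoly d a' := by
  have h : (C u + C v : ℝ[X]) = 1 := by rw [← C_add, huv, C_1]
  simp only [Qpoly, Pi.add_apply, Pi.smul_apply, smul_eq_mul, C_add, C_mul, add_mul,
    Finset.sum_add_distrib, mul_add, Finset.mul_sum, mul_assoc]
  linear_combination -X ^ d * h

theorem convex_rootFiber (d : ℕ) (ε : Fin d → ℝ) (b : ℝ × ℝ) : Convex ℝ (rootFiber d ε b) := by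
  rintro a ⟨ha, W, hW, hWpos⟩ a' ⟨ha', W', hW', hWpos'⟩ u v hu hv huv
  have key : ∀ x y : ℝ, 0 < x → 0 < y → 0 < u * x + v * y := fun x y hx hy => by
    rcases hu.eq_or_lt with rfl | hu
    · rw [zero_add] at huv
      simpa [huv] using hy
    · positivity
  refine ⟨fun j => ?_, C u * W + C v * W', ?_, fun x => ?_⟩
  · have := key _ _ (ha j) (ha' j)
    simp only [Pi.add_apply, Pi.smul_apply, smul_eq_mul]
    linarith
  · rw [Qpoly_combo d a a' huv, hW, hW']
    ring
  · simpa using key _ _ (hWpos x) (hWpos' x)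

theorem exists_local_selection {d : ℕ} {ε : Fin d → ℝ} {b : ℝ × ℝ}
    (hb : (rootFiber d ε b).Nonempty) :
    ∃ g : ℝ × ℝ → Fin d → ℝ, Continuous g ∧ ∀ᶠ c in 𝓝 b, g c ∈ rootFiber d ε c := by
  obtain ⟨a, ha, W, hW, hWpos⟩ := hb
  have hm : ∀ c : ℝ × ℝ, ((X - C c.2) * (X + C c.1)).Monic := fun c =>
    (monic_X_sub_C _).mul (monic_X_add_C _)
  have hWm : W.Monic := (hm b).of_mul_monic_left (hW ▸ monic_Qpoly d a)
  have hdeg : ∀ c : ℝ × ℝ, ((X - C c.2) * (X + C c.1) * W).natDegree = d := fun c => by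
    have h := natDegree_Qpoly d a
    rw [hW] at h
    rw [← h, (hm c).natDegree_mul hWm, (hm b).natDegree_mul hWm,
      (monic_X_sub_C _).natDegree_mul (monic_X_add_C _),
      (monic_X_sub_C _).natDegree_mul (monic_X_add_C _)]
    simp
  have hcont : ∀ j : ℕ, Continuous fun c : ℝ × ℝ => ((X - C c.2) * (X + C c.1) * W).coeff j := by
    intro j
    have : ∀ c : ℝ × ℝ, ((X - C c.2) * (X + C c.1) * W).coeff j =
        (X * X * W).coeff j + (c.1 - c.2) * (X * W).coeff j - c.2 * c.1 * W.coeff j := by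
      intro c
      rw [← coeff_C_mul, ← coeff_C_mul, ← coeff_add, ← coeff_sub]
      congr 1
      simp only [C_sub, C_mul]
      ring
    simp only [this]
    fun_prop
  refine ⟨fun c j => ((X - C c.2) * (X + C c.1) * W).coeff j,
    continuous_pi fun j => hcont j, ?_⟩
  have hsign : ∀ᶠ c in 𝓝 b, ∀ j : Fin d, 0 < ε j * ((X - C c.2) * (X + C c.1) * W).coeff j := by
    refine eventually_all.2 fun j => ?_
    refine (continuous_const.mul (hcont j)).continuousAt.eventually (lt_mem_nhds ?_)
    rw [Pi.mul_apply, ← hW, coeff_Qpoly]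
    exact ha j
  filter_upwards [hsign] with c hc
  exact ⟨hc, W, Qpoly_coeff ((hm c).mul hWm) (hdeg c), hWpos⟩

theorem eval_neg_iff {d : ℕ} {ε a : Fin d → ℝ} {b : ℝ × ℝ} (ha : a ∈ rootFiber d ε b) (x : ℝ) :
    (Qpoly d a).eval x < 0 ↔ (x - b.2) * (x + b.1) < 0 := by
  obtain ⟨-, W, hW, hWpos⟩ := ha
  rw [hW, eval_mul, ← not_le, ← not_le, mul_nonneg_iff_of_pos_right (hWpos x)]
  simp

theorem eval_pos_iff {d : ℕ} {ε a : Fin d → ℝ} {b : ℝ × ℝ} (ha : a ∈ rootFiber d ε b) (x : ℝ) :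
    0 < (Qpoly d a).eval x ↔ 0 < (x - b.2) * (x + b.1) := by
  obtain ⟨-, W, hW, hWpos⟩ := ha
  simp [hW, mul_pos_iff_of_pos_right, hWpos x]

theorem eval_neg_iff_lt {d : ℕ} {ε a : Fin d → ℝ} {b : ℝ × ℝ} (ha : a ∈ rootFiber d ε b)
    (hb : 0 < b.1) {x : ℝ} (hx : 0 < x) : (Qpoly d a).eval x < 0 ↔ x < b.2 := by
  rw [eval_neg_iff ha, mul_neg_iff]
  constructor
  · rintro (h | h) <;> linarith
  · intro h; right; constructor <;> linarith

theorem eval_pos_iff_lt {d : ℕ} {ε a : Fin d → ℝ} {b : ℝ × ℝ} (ha : a ∈ rootFiber d ε b)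
    (hb : 0 < b.1) {x : ℝ} (hx : 0 < x) : 0 < (Qpoly d a).eval x ↔ b.2 < x := by
  rw [eval_pos_iff ha, mul_pos_iff]
  constructor
  · rintro (h | h) <;> linarith
  · intro h; left; constructor <;> linarith

theorem eval_neg_neg_iff_lt {d : ℕ} {ε a : Fin d → ℝ} {b : ℝ × ℝ} (ha : a ∈ rootFiber d ε b)
    (hb : 0 < b.2) {x : ℝ} (hx : 0 < x) : (Qpoly d a).eval (-x) < 0 ↔ x < b.1 := by
  rw [eval_neg_iff ha, mul_neg_iff]
  constructor
  · rintro (h | h) <;> linarith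
  · intro h; right; constructor <;> linarith

theorem eval_neg_pos_iff_lt {d : ℕ} {ε a : Fin d → ℝ} {b : ℝ × ℝ} (ha : a ∈ rootFiber d ε b)
    (hb : 0 < b.2) {x : ℝ} (hx : 0 < x) : 0 < (Qpoly d a).eval (-x) ↔ b.1 < x := by
  rw [eval_pos_iff ha, mul_pos_iff]
  constructor
  · rintro (h | h) <;> linarith
  · intro h; right; constructor <;> linarith

theorem rootFiber_unique {d : ℕ} {ε a : Fin d → ℝ} {b c : ℝ × ℝ} (hb : a ∈ rootFiber d ε b)
    (hc : a ∈ rootFiber d ε c) (hb₁ : 0 < b.1) (hb₂ : 0 < b.2) (hc₁ : 0 < c.1) (hc₂ : 0 < c.2) :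
    b = c := by
  ext
  · refine le_antisymm (not_lt.1 fun h => ?_) (not_lt.1 fun h => ?_)
    · exact lt_irrefl _ ((eval_neg_neg_iff_lt hc hc₂ hc₁).1 ((eval_neg_neg_iff_lt hb hb₂ hc₁).2 h))
    · exact lt_irrefl _ ((eval_neg_neg_iff_lt hb hb₂ hb₁).1 ((eval_neg_neg_iff_lt hc hc₂ hb₁).2 h))
  · refine le_antisymm (not_lt.1 fun h => ?_) (not_lt.1 fun h => ?_)
    · exact lt_irrefl _ ((eval_neg_iff_lt hc hc₁ hc₂).1 ((eval_neg_iff_lt hb hb₁ hc₂).2 h))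
    · exact lt_irrefl _ ((eval_neg_iff_lt hb hb₁ hb₂).1 ((eval_neg_iff_lt hc hc₁ hb₂).2 h))

theorem continuousOn_roots {d : ℕ} {ε : Fin d → ℝ} {G : Set (Fin d → ℝ)}
    {π : (Fin d → ℝ) → ℝ × ℝ}
    (hπ : ∀ a ∈ G, 0 < (π a).1 ∧ 0 < (π a).2 ∧ a ∈ rootFiber d ε (π a)) : ContinuousOn π G := by
  have hev : ∀ x, Continuous fun a => (Qpoly d a).eval x := fun x => by
    simp only [eval_Qpoly]
    fun_prop
  intro a ha
  obtain ⟨h₁, h₂, hf⟩ := hπ a ha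
  have hlt : ∀ x, (Qpoly d a).eval x < 0 → ∀ᶠ c in 𝓝[G] a, (Qpoly d c).eval x < 0 := fun x hx =>
    ((hev x).continuousWithinAt (s := G)).eventually (gt_mem_nhds hx)
  have hgt : ∀ x, 0 < (Qpoly d a).eval x → ∀ᶠ c in 𝓝[G] a, 0 < (Qpoly d c).eval x := fun x hx =>
    ((hev x).continuousWithinAt (s := G)).eventually (lt_mem_nhds hx)
  refine Tendsto.prodMk_nhds (tendsto_order.2 ⟨fun u hu => ?_, fun u hu => ?_⟩)
    (tendsto_order.2 ⟨fun u hu => ?_, fun u hu => ?_⟩)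
  · rcases le_or_gt u 0 with hu0 | hu0
    · filter_upwards [self_mem_nhdsWithin] with c hc using hu0.trans_lt (hπ c hc).1
    · filter_upwards [self_mem_nhdsWithin, hlt _ ((eval_neg_neg_iff_lt hf h₂ hu0).2 hu)]
        with c hc hcu
      exact (eval_neg_neg_iff_lt (hπ c hc).2.2 (hπ c hc).2.1 hu0).1 hcu
  · have hu0 := h₁.trans hu
    filter_upwards [self_mem_nhdsWithin, hgt _ ((eval_neg_pos_iff_lt hf h₂ hu0).2 hu)] with c hc hcu
    exact (eval_neg_pos_iff_lt (hπ c hc).2.2 (hπ c hc).2.1 hu0).1 hcu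
  · rcases le_or_gt u 0 with hu0 | hu0
    · filter_upwards [self_mem_nhdsWithin] with c hc using hu0.trans_lt (hπ c hc).2.1
    · filter_upwards [self_mem_nhdsWithin, hlt _ ((eval_neg_iff_lt hf h₁ hu0).2 hu)] with c hc hcu
      exact (eval_neg_iff_lt (hπ c hc).2.2 (hπ c hc).1 hu0).1 hcu
  · have hu0 := h₂.trans hu
    filter_upwards [self_mem_nhdsWithin, hgt _ ((eval_pos_iff_lt hf h₁ hu0).2 hu)] with c hc hcu
    exact (eval_pos_iff_lt (hπ c hc).2.2 (hπ c hc).1 hu0).1 hcu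

theorem exists_eq_mul_of_roots {P : ℝ[X]} {s t : ℝ} (hst : t ≠ -s) (ht : P.eval t = 0)
    (hs : P.eval (-s) = 0) : ∃ U : ℝ[X], P = (X - C t) * (X + C s) * U := by
  have hs' : (X + C s : ℝ[X]) = X - C (-s) := by simp
  rw [hs']
  exact (isCoprime_X_sub_C_of_isUnit_sub (sub_ne_zero.2 hst).isUnit).mul_dvd
    (dvd_iff_isRoot.2 ht) (dvd_iff_isRoot.2 hs)

theorem eval_derivative_left (s t : ℝ) (U : ℝ[X]) :
    (derivative ((X - C t) * (X + C s) * U)).eval t = (t + s) * U.eval t := by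
  simp

theorem eval_derivative_right (s t : ℝ) (U : ℝ[X]) :
    (derivative ((X - C t) * (X + C s) * U)).eval (-s) = -((t + s) * U.eval (-s)) := by
  simp
  ring

theorem exists_abs_eval_le_mul_eval {U V : ℝ[X]} (hU : ∀ x, 0 < U.eval x)
    (hVU : V.degree ≤ U.degree) : ∃ K, ∀ x, |V.eval x| ≤ K * U.eval x := by
  have hc : Continuous fun x => V.eval x / U.eval x :=
    V.continuous.div U.continuous fun x => (hU x).ne'
  have hO : (fun x => V.eval x / U.eval x) =O[cocompact ℝ] (1 : ℝ → ℝ) := by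
    obtain ⟨K, hK⟩ := (isBigO_cobounded_of_degree_le hVU).bound
    rw [Metric.cobounded_eq_cocompact] at hK
    refine Asymptotics.IsBigO.of_bound K ?_
    filter_upwards [hK] with x hx
    rw [norm_div, Pi.one_apply, norm_one, mul_one, div_le_iff₀ (norm_pos_iff.2 (hU x).ne')]
    exact hx
  obtain ⟨K, hK⟩ := isBounded_iff_forall_norm_le.1 (hc.isBounded_range_iff_isBigO.2 hO)
  refine ⟨K, fun x => ?_⟩
  have := hK _ ⟨x, rfl⟩
  rwa [norm_div, Real.norm_eq_abs, Real.norm_eq_abs, abs_of_pos (hU x), div_le_iff₀ (hU x)] at this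

theorem Qpoly_add_smul (d : ℕ) (p τ : Fin d → ℝ) (η : ℝ) :
    Qpoly d (p + η • τ) = Qpoly d p + C η * ∑ j, C (τ j) * X ^ (j : ℕ) := by
  simp only [Qpoly, Pi.add_apply, Pi.smul_apply, smul_eq_mul, C_add, C_mul, add_mul,
    Finset.sum_add_distrib, Finset.mul_sum, mul_assoc, add_assoc]

/-- A polynomial with the right roots can be perturbed, keeping the roots, to acquire the sign
pattern `ε`. -/
theorem rootFiber_nonempty_of_perturbation {d : ℕ} {ε p τ : Fin d → ℝ} {s t : ℝ} {U : ℝ[X]}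
    (hst : t ≠ -s) (hp : Qpoly d p = (X - C t) * (X + C s) * U) (hU : ∀ x, 0 < U.eval x)
    (hτt : ∑ j, τ j * t ^ (j : ℕ) = 0) (hτs : ∑ j, τ j * (-s) ^ (j : ℕ) = 0)
    (hε : ∀ j, 0 < ε j * p j ∨ 0 ≤ ε j * p j ∧ 0 < ε j * τ j) :
    (rootFiber d ε (s, t)).Nonempty := by
  obtain ⟨V, hV⟩ := exists_eq_mul_of_roots (P := ∑ j, C (τ j) * X ^ (j : ℕ)) hst
    (by simpa [eval_finsetSum] using hτt) (by simpa [eval_finsetSum] using hτs)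
  have hVU : V.degree ≤ U.degree := by
    have h₁ := degree_sum_fin_lt τ
    have h₂ : (Qpoly d p).degree = d := by
      rw [degree_eq_natDegree (monic_Qpoly d p).ne_zero, natDegree_Qpoly]
    rw [hV, ← h₂, hp, degree_mul, degree_mul (q := U)] at h₁
    exact (lt_of_add_lt_add_left h₁).le
  obtain ⟨K, hK⟩ := exists_abs_eval_le_mul_eval hU hVU
  have hηK : ∀ᶠ η : ℝ in 𝓝[>] 0, η * K < 1 := by
    have : Continuous fun η : ℝ => η * K := by fun_prop
    exact nhdsWithin_le_nhds (this.continuousAt.eventually (gt_mem_nhds (by simp)))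
  have hsign : ∀ᶠ η : ℝ in 𝓝[>] 0, ∀ j, 0 < ε j * (p j + η * τ j) := by
    refine eventually_all.2 fun j => ?_
    rcases hε j with h | ⟨h, h'⟩
    · have : Continuous fun η : ℝ => ε j * (p j + η * τ j) := by fun_prop
      exact nhdsWithin_le_nhds (this.continuousAt.eventually (lt_mem_nhds (by simpa using h)))
    · filter_upwards [self_mem_nhdsWithin] with η hη
      have := mul_pos (Set.mem_Ioi.1 hη) h'
      linarith
  obtain ⟨η, ⟨hη, hη₀⟩, hs⟩ := ((hηK.and self_mem_nhdsWithin).and hsign).exists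
  refine ⟨p + η • τ, hs, U + C η * V, ?_, fun x => ?_⟩
  · rw [Qpoly_add_smul, hp, hV]
    ring
  · have h₁ := hK x
    have h₂ : -V.eval x ≤ K * U.eval x := (neg_le_abs _).trans h₁
    have h₃ := mul_le_mul_of_nonneg_left h₂ (Set.mem_Ioi.1 hη₀).le
    have h₄ := mul_lt_mul_of_pos_right hη (hU x)
    simp only [eval_add, eval_mul, eval_C]
    linarith

theorem pow_add_mul_pow_lt_of_pos_right {k m : ℕ} (hk : k ≠ 0) (hkm : k < m) {c x y : ℝ} (hx : 0 ≤ x)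
    (hxy : x < y) (hy : 0 < y ^ m + c * y ^ k) : x ^ m + c * x ^ k < y ^ m + c * y ^ k := by
  obtain ⟨n, rfl⟩ := Nat.exists_eq_add_of_lt hkm
  have hn : n + 1 ≠ 0 := by simp
  have e : ∀ z : ℝ, z ^ (k + n + 1) + c * z ^ k = z ^ k * (z ^ (n + 1) + c) := fun z => by ring
  rw [e] at hy
  rw [e, e]
  have h₁ := pow_lt_pow_left₀ hxy hx hk
  have h₂ := pow_lt_pow_left₀ hxy hx hn
  have h₀ : 0 ≤ x ^ k := pow_nonneg hx k
  have h₃ := pos_of_mul_pos_right hy (h₀.trans h₁.le)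
  rcases le_or_gt (x ^ (n + 1) + c) 0 with h | h
  · exact (mul_nonpos_of_nonneg_of_nonpos h₀ h).trans_lt hy
  · exact mul_lt_mul'' h₁ (by linarith) h₀ h.le

theorem pow_add_mul_pow_lt_of_pos_left {k m : ℕ} (hk : k ≠ 0) (hkm : k < m) {c x y : ℝ} (hx : 0 < x)
    (hxy : x < y) (hpos : 0 < x ^ m + c * x ^ k) :
    x ^ m + c * x ^ k < y ^ m + c * y ^ k := by
  refine pow_add_mul_pow_lt_of_pos_right hk hkm hx.le hxy ?_
  by_contra! h
  obtain ⟨n, rfl⟩ := Nat.exists_eq_add_of_lt hkm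
  have e : ∀ z : ℝ, z ^ (k + n + 1) + c * z ^ k = z ^ k * (z ^ (n + 1) + c) := fun z => by ring
  rw [e] at hpos h
  have h₁ := pos_of_mul_pos_right hpos (pow_nonneg hx.le k)
  have h₂ := pow_lt_pow_left₀ hxy hx.le (show n + 1 ≠ 0 by simp)
  have := mul_pos (pow_pos (hx.trans hxy) k) (show 0 < y ^ (n + 1) + c by linarith)
  linarith

theorem derivative_pow_add_mul_pow_pos {k m : ℕ} (hkm : k < m) {c x : ℝ}
    (hx : 0 < x) (hpos : 0 < x ^ m + c * x ^ k) :
    0 < x * (m * x ^ (m - 1) + c * (k * x ^ (k - 1))) := by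
  have hpow : ∀ n : ℕ, x * (n * x ^ (n - 1)) = n * x ^ n := by
    rintro (_ | n)
    · simp
    · rw [Nat.add_sub_cancel]
      ring
  have : x * (m * x ^ (m - 1) + c * (k * x ^ (k - 1))) =
      (m - k) * x ^ m + k * (x ^ m + c * x ^ k) := by
    rw [mul_add, hpow, mul_left_comm, hpow]
    ring
  rw [this]
  have hm : (0 : ℝ) < m - k := sub_pos.2 (Nat.cast_lt.2 hkm)
  have := mul_pos hm (pow_pos hx m)
  positivity

/-- A trinomial `x^d + c x^k - δ` with positive `δ`, `d` even and `k` odd has exactly one positive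
and one negative root, both simple. -/
theorem trinomial_factor {d k : ℕ} (hd : Even d) (hk : Odd k) (hkd : k < d) {c δ s t : ℝ}
    (hδ : 0 < δ) (hs : 0 < s) (ht : 0 < t) (htδ : t ^ d + c * t ^ k = δ)
    (hsδ : s ^ d + -c * s ^ k = δ) :
    ∃ U : ℝ[X], X ^ d + C c * X ^ k - C δ = (X - C t) * (X + C s) * U ∧ ∀ x, 0 < U.eval x := by
  have hk₀ : k ≠ 0 := hk.pos.ne'
  have hneg : ∀ y : ℝ, (-y) ^ d + c * (-y) ^ k = y ^ d + -c * y ^ k := fun y => by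
    rw [hd.neg_pow, hk.neg_pow]
    ring
  obtain ⟨U, hU⟩ := exists_eq_mul_of_roots (P := X ^ d + C c * X ^ k - C δ) (s := s) (t := t)
    (by linarith) (by simp [htδ]) (by simp only [eval_sub, eval_add, eval_mul, eval_pow, eval_X, eval_C, hneg, hsδ, sub_self])
  have hev : ∀ x, x ^ d + c * x ^ k - δ = (x - t) * (x + s) * U.eval x := fun x => by
    simpa using congrArg (eval x) hU
  refine ⟨U, hU, fun x => ?_⟩
  rcases eq_or_ne x t with rfl | hxt
  · have h := derivative_pow_add_mul_pow_pos hkd ht (htδ ▸ hδ)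
    have h' := eval_derivative_left s x U
    rw [← hU] at h'
    simp only [derivative_sub, derivative_add, derivative_X_pow, derivative_C_mul, derivative_C,
      eval_add, eval_mul, eval_C, eval_pow, eval_X, sub_zero, eval_natCast, map_natCast] at h'
    rw [h', ← mul_assoc] at h
    exact pos_of_mul_pos_right h (by positivity)
  rcases eq_or_ne x (-s) with rfl | hxs
  · have h := derivative_pow_add_mul_pow_pos hkd hs (hsδ ▸ hδ)
    have h' := eval_derivative_right s t U
    rw [← hU] at h'
    simp only [derivative_sub, derivative_add, derivative_X_pow, derivative_C_mul, derivative_C,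
      eval_add, eval_mul, eval_C, eval_pow, eval_X, sub_zero, eval_natCast, map_natCast] at h'
    have hd' : Odd (d - 1) := Nat.Even.sub_odd (by omega) hd odd_one
    have hk' : Even (k - 1) := Nat.Odd.sub_odd hk odd_one
    rw [hd'.neg_pow, hk'.neg_pow] at h'
    have h'' : d * s ^ (d - 1) + -c * (k * s ^ (k - 1)) = (t + s) * U.eval (-s) := by linarith
    rw [h'', ← mul_assoc] at h
    exact pos_of_mul_pos_right h (by positivity)
  have hsgn : 0 < (x - t) * (x + s) * (x ^ d + c * x ^ k - δ) := by
    rcases le_or_gt 0 x with hx | hx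
    · rcases hxt.lt_or_gt with h | h
      · have := pow_add_mul_pow_lt_of_pos_right hk₀ hkd hx h (htδ ▸ hδ)
        have h₁ := mul_pos (sub_pos.2 h) (show 0 < x + s by linarith)
        have h₂ := mul_pos h₁ (show 0 < δ - (x ^ d + c * x ^ k) by linarith)
        linarith
      · have := pow_add_mul_pow_lt_of_pos_left hk₀ hkd ht h (htδ ▸ hδ)
        exact mul_pos (mul_pos (by linarith) (by linarith)) (by linarith)
    · obtain ⟨y, rfl⟩ : ∃ y, x = -y := ⟨-x, by ring⟩
      rw [hneg]
      have hy : 0 < y := by linarith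
      have hys : y ≠ s := fun h => hxs (by rw [h])
      rcases hys.lt_or_gt with h | h
      · have := pow_add_mul_pow_lt_of_pos_right hk₀ hkd hy.le h (hsδ ▸ hδ)
        have h₁ := mul_pos (sub_pos.2 h) (show 0 < y + t by linarith)
        have h₂ := mul_pos h₁ (show 0 < δ - (y ^ d + -c * y ^ k) by linarith)
        linarith
      · have := pow_add_mul_pow_lt_of_pos_left hk₀ hkd hs h (hsδ ▸ hδ)
        have h₁ := mul_pos (sub_pos.2 h) (show 0 < y + t by linarith)
        have h₂ := mul_pos h₁ (show 0 < y ^ d + -c * y ^ k - δ by linarith)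
        linarith
  rw [hev, ← mul_assoc] at hsgn
  exact pos_of_mul_pos_right hsgn (mul_self_nonneg _)

theorem sum_single_mul_pow {d : ℕ} (i : Fin d) (c x : ℝ) :
    ∑ j, (Pi.single i c : Fin d → ℝ) j * x ^ (j : ℕ) = c * x ^ (i : ℕ) := by
  simp [Pi.single_apply]

theorem rootFiber_nonempty_of_odd {d : ℕ} (hd : 0 < d) (hdeven : Even d) {ε σ : Fin d → ℝ}
    (hε0 : ε ⟨0, hd⟩ = -1) {k : Fin d} (hk : Odd (k : ℕ)) {s t : ℝ} (hs : 0 < s) (ht : 0 < t)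
    (hσk : σ k = 0) (hσ : ∀ j ≠ k, 0 < ε j * σ j)
    (hεk : 0 < ε k * (s ^ d - t ^ d) ∨ s = t ∧
      ε k * (∑ j, σ j * t ^ (j : ℕ) - ∑ j, σ j * (-s) ^ (j : ℕ)) < 0) :
    (rootFiber d ε (s, t)).Nonempty := by
  set D := ∑ j, σ j * t ^ (j : ℕ) - ∑ j, σ j * (-s) ^ (j : ℕ) with hD
  have hsum : 0 < s ^ (k : ℕ) + t ^ (k : ℕ) := by positivity
  set c := (s ^ d - t ^ d) / (s ^ (k : ℕ) + t ^ (k : ℕ)) with hc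
  set α := -D / (s ^ (k : ℕ) + t ^ (k : ℕ)) with hα
  have hc' : c * (s ^ (k : ℕ) + t ^ (k : ℕ)) = s ^ d - t ^ d := div_mul_cancel₀ _ hsum.ne'
  have hα' : α * (s ^ (k : ℕ) + t ^ (k : ℕ)) = -D := div_mul_cancel₀ _ hsum.ne'
  set δ := t ^ d + c * t ^ (k : ℕ) with hδ
  have hδpos : 0 < δ := by
    have h : δ * (s ^ (k : ℕ) + t ^ (k : ℕ)) = t ^ d * s ^ (k : ℕ) + s ^ d * t ^ (k : ℕ) := by
      rw [hδ]
      linear_combination t ^ (k : ℕ) * hc'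
    refine pos_of_mul_pos_left ?_ hsum.le
    rw [h]
    positivity
  obtain ⟨U, hU, hUpos⟩ := trinomial_factor hdeven hk k.2 hδpos hs ht hδ.symm
    (by rw [hδ]; linear_combination -hc')
  have hk0 : k ≠ ⟨0, hd⟩ := by
    rintro rfl
    simp at hk
  refine rootFiber_nonempty_of_perturbation (U := U)
    (p := Pi.single ⟨0, hd⟩ (-δ) + Pi.single k c)
    (τ := σ + Pi.single k α + Pi.single ⟨0, hd⟩ (-(∑ j, σ j * t ^ (j : ℕ)) - α * t ^ (k : ℕ)))
    (by linarith) ?_ hUpos ?_ ?_ fun j => ?_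
  · rw [← hU]
    simp [Qpoly, Pi.single_apply, add_mul, Finset.sum_add_distrib, apply_ite (C : ℝ → ℝ[X])]
    ring
  · simp only [Pi.add_apply, add_mul, Finset.sum_add_distrib, sum_single_mul_pow]
    ring
  · simp only [Pi.add_apply, add_mul, Finset.sum_add_distrib, sum_single_mul_pow, hk.neg_pow]
    linear_combination -hα' - hD
  · rcases eq_or_ne j ⟨0, hd⟩ with rfl | hj0
    · left
      simpa [hk0.symm, hε0] using hδpos
    · rcases eq_or_ne j k with rfl | hjk
      · rcases hεk with h | ⟨rfl, h⟩
        · left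
          have := div_pos h hsum
          simpa [hj0, hc, mul_div_assoc] using this
        · right
          have := div_pos (neg_pos.2 h) hsum
          refine ⟨by simp [hj0, hc], ?_⟩
          simpa [hj0, hσk, hα, mul_div_assoc, neg_div] using this
      · right
        simpa [hj0, hjk] using hσ j hjk

theorem sum_mul_pow_sub_neg_pow_pos {d : ℕ} (hd : 1 < d) {w : Fin d → ℝ}
    (hw : ∀ j : Fin d, Odd (j : ℕ) → 0 < w j) {x : ℝ} (hx : 0 < x) :
    0 < ∑ j, w j * (x ^ (j : ℕ) - (-x) ^ (j : ℕ)) := by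
  have hodd : ∀ j : Fin d, Odd (j : ℕ) → 0 < w j * (x ^ (j : ℕ) - (-x) ^ (j : ℕ)) := by
    intro j hj
    rw [hj.neg_pow, sub_neg_eq_add]
    have := hw j hj
    positivity
  refine Finset.sum_pos' (fun j _ => ?_) ⟨⟨1, hd⟩, Finset.mem_univ _, hodd _ odd_one⟩
  rcases Nat.even_or_odd (j : ℕ) with hj | hj
  · simp [hj.neg_pow]
  · exact (hodd j hj).le

theorem eval_Qpoly_sub_eval_neg {d : ℕ} (hd : Even d) (a : Fin d → ℝ) (x : ℝ) :
    (Qpoly d a).eval x - (Qpoly d a).eval (-x) =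
      ∑ j, a j * (x ^ (j : ℕ) - (-x) ^ (j : ℕ)) := by
  simp only [eval_Qpoly, hd.neg_pow, mul_sub, Finset.sum_sub_distrib]
  ring

theorem rootFiber_nonempty_iff {d : ℕ} (hd : 0 < d) (hdeven : Even d) {ε : Fin d → ℝ}
    (hε : ∀ j, ε j = 1 ∨ ε j = -1) (hε0 : ε ⟨0, hd⟩ = -1) {s t : ℝ} (hs : 0 < s) (ht : 0 < t) :
    (rootFiber d ε (s, t)).Nonempty ↔
      ((∃ l : Fin d, Odd (l : ℕ) ∧ ε l = -1) ∨ t < s) ∧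
        ((∃ k : Fin d, Odd (k : ℕ) ∧ ε k = 1) ∨ s < t) := by
  have hd1 : 1 < d := by
    obtain ⟨n, rfl⟩ := hdeven
    omega
  have hsq : ∀ j, 0 < ε j * ε j := fun j => by rcases hε j with h | h <;> simp [h]
  constructor
  · rintro ⟨a, ha⟩
    obtain ⟨hsign, W, hW, -⟩ := id ha
    constructor
    · by_contra! h
      have hpos := sum_mul_pow_sub_neg_pow_pos hd1 (w := a) (x := t) (fun j hj => by
        have := hsign j
        rwa [(hε j).resolve_right (h.1 j hj), one_mul] at this) ht
      rw [← eval_Qpoly_sub_eval_neg hdeven] at hpos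
      have h0 : (Qpoly d a).eval t = 0 := by simp [hW]
      have := (eval_neg_neg_iff_lt ha ht ht).1 (by linarith)
      exact absurd this h.2.not_gt
    · by_contra! h
      have hpos := sum_mul_pow_sub_neg_pow_pos hd1 (w := -a) (x := s) (fun j hj => by
        have := hsign j
        rwa [(hε j).resolve_left (h.1 j hj), neg_one_mul] at this) hs
      simp only [Pi.neg_apply, neg_mul, Finset.sum_neg_distrib] at hpos
      rw [← eval_Qpoly_sub_eval_neg hdeven] at hpos
      have h0 : (Qpoly d a).eval (-s) = 0 := by simp [hW]
      have := (eval_neg_iff_lt ha hs hs).1 (by linarith)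
      exact absurd this h.2.not_gt
  · rintro ⟨h₁, h₂⟩
    have hupd : ∀ k j, j ≠ k → 0 < ε j * Function.update ε k 0 j := fun k j hj => by
      rw [Function.update_of_ne hj]
      exact hsq j
    rcases lt_trichotomy t s with hlt | rfl | hlt
    · obtain ⟨k, hk, hεk⟩ := h₂.resolve_right hlt.not_gt
      refine rootFiber_nonempty_of_odd hd hdeven hε0 hk hs ht (Function.update_self k 0 ε)
        (hupd k) (.inl ?_)
      rw [hεk, one_mul, sub_pos]
      exact pow_lt_pow_left₀ hlt ht.le hd.ne'
    · obtain ⟨l, hl, hεl⟩ := h₁.resolve_right (lt_irrefl _)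
      obtain ⟨k, hk, hεk⟩ := h₂.resolve_right (lt_irrefl _)
      have hkl : k ≠ l := by
        rintro rfl
        linarith
      set σ := Function.update ε k 0 with hσ
      set D := ∑ j, σ j * t ^ (j : ℕ) - ∑ j, σ j * (-t) ^ (j : ℕ) with hD
      have htl : 0 < t ^ (l : ℕ) := by positivity
      set M := (|D| + 1) / t ^ (l : ℕ) with hM
      have hM₀ : 0 < M := by positivity
      have hMt : M * t ^ (l : ℕ) = |D| + 1 := div_mul_cancel₀ _ htl.ne'
      refine rootFiber_nonempty_of_odd (σ := σ + Pi.single l (-M)) hd hdeven hε0 hk hs ht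
        (by simp [hσ, hkl]) (fun j hj => ?_) (.inr ⟨rfl, ?_⟩)
      · rcases eq_or_ne j l with rfl | hjl
        · simp only [Pi.add_apply, hσ, Function.update_of_ne hj, Pi.single_eq_same, hεl]
          linarith
        · simpa [hjl] using hupd k j hj
      · simp only [Pi.add_apply, add_mul, Finset.sum_add_distrib, sum_single_mul_pow, hl.neg_pow,
          hεk]
        have := le_abs_self D
        have := abs_nonneg D
        linarith
    · obtain ⟨l, hl, hεl⟩ := h₁.resolve_right hlt.not_gt
      refine rootFiber_nonempty_of_odd hd hdeven hε0 hl hs ht (Function.update_self l 0 ε)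
        (hupd l) (.inl ?_)
      rw [hεl, neg_one_mul, neg_sub, sub_pos]
      exact pow_lt_pow_left₀ hlt hs.le hd.ne'

theorem convex_setOf_rootFiber_nonempty {d : ℕ} (hd : 0 < d) (hdeven : Even d) {ε : Fin d → ℝ}
    (hε : ∀ j, ε j = 1 ∨ ε j = -1) (hε0 : ε ⟨0, hd⟩ = -1) :
    Convex ℝ {b : ℝ × ℝ | 0 < b.1 ∧ 0 < b.2 ∧ (rootFiber d ε b).Nonempty} := by
  have hfst : IsLinearMap ℝ (Prod.fst : ℝ × ℝ → ℝ) := ⟨fun _ _ => rfl, fun _ _ => rfl⟩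
  have hsnd : IsLinearMap ℝ (Prod.snd : ℝ × ℝ → ℝ) := ⟨fun _ _ => rfl, fun _ _ => rfl⟩
  have hor : ∀ (p : Prop) (s : Set (ℝ × ℝ)), Convex ℝ s → Convex ℝ {b | p ∨ b ∈ s} := by
    intro p s hs
    by_cases hp : p
    · simp [hp, convex_univ]
    · simpa [hp] using hs
  have hsub : IsLinearMap ℝ (fun b : ℝ × ℝ => b.1 - b.2) := (hfst.mk' _ - hsnd.mk' _).isLinear
  have heq : {b : ℝ × ℝ | 0 < b.1 ∧ 0 < b.2 ∧ (rootFiber d ε b).Nonempty} =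
      ({b | 0 < b.1} ∩ {b | 0 < b.2}) ∩
        ({b | (∃ l : Fin d, Odd (l : ℕ) ∧ ε l = -1) ∨ b ∈ {b : ℝ × ℝ | 0 < b.1 - b.2}} ∩
        {b | (∃ k : Fin d, Odd (k : ℕ) ∧ ε k = 1) ∨ b ∈ {b : ℝ × ℝ | b.1 - b.2 < 0}}) := by
    ext b
    simp only [Set.mem_ofPred_eq, Set.mem_inter_iff, ← and_assoc, sub_pos, sub_neg]
    simp only [and_assoc]
    refine and_congr_right fun h₁ => and_congr_right fun h₂ => ?_
    exact rootFiber_nonempty_iff hd hdeven hε hε0 h₁ h₂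
  rw [heq]
  exact ((convex_halfSpace_gt hfst 0).inter (convex_halfSpace_gt hsnd 0)).inter
    ((hor _ _ (convex_halfSpace_gt hsub 0)).inter (hor _ _ (convex_halfSpace_lt hsub 0)))

theorem exists_rootFiber_nonempty {d : ℕ} (hd : 0 < d) (hdeven : Even d) {ε : Fin d → ℝ}
    (hε : ∀ j, ε j = 1 ∨ ε j = -1) (hε0 : ε ⟨0, hd⟩ = -1) :
    {b : ℝ × ℝ | 0 < b.1 ∧ 0 < b.2 ∧ (rootFiber d ε b).Nonempty}.Nonempty := by
  have hd1 : 1 < d := by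
    obtain ⟨n, rfl⟩ := hdeven
    omega
  rcases hε ⟨1, hd1⟩ with h | h
  · exact ⟨(2, 1), by norm_num, by norm_num, (rootFiber_nonempty_iff hd hdeven hε hε0
      (by norm_num) (by norm_num)).2 ⟨.inr (by norm_num), .inl ⟨_, odd_one, h⟩⟩⟩
  · exact ⟨(1, 2), by norm_num, by norm_num, (rootFiber_nonempty_iff hd hdeven hε hε0
      (by norm_num) (by norm_num)).2 ⟨.inl ⟨_, odd_one, h⟩, .inr (by norm_num)⟩⟩

theorem twoSimpleRoots_of_mem_rootFiber {d : ℕ} {ε a : Fin d → ℝ} {b : ℝ × ℝ}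
    (ha : a ∈ rootFiber d ε b) (h₁ : 0 < b.1) (h₂ : 0 < b.2) :
    TwoSimpleRoots d a (-b.1) b.2 := by
  obtain ⟨-, W, hW, hWpos⟩ := ha
  have hsum : b.2 + b.1 ≠ 0 := by positivity
  refine ⟨by linarith, by simp [hW], by simp [hW], ?_, ?_, fun x hx => ?_⟩
  · rw [hW, eval_derivative_right]
    exact neg_ne_zero.2 (mul_ne_zero hsum (hWpos _).ne')
  · rw [hW, eval_derivative_left]
    exact mul_ne_zero hsum (hWpos _).ne'
  · rw [hW, eval_mul, mul_eq_zero, or_iff_left (hWpos x).ne', eval_mul, mul_eq_zero] at hx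
    simp only [eval_sub, eval_add, eval_X, eval_C] at hx
    rcases hx with hx | hx
    · right; linarith
    · left; linarith

theorem TwoSimpleRoots.symm {d : ℕ} {a : Fin d → ℝ} {r₁ r₂ : ℝ} (h : TwoSimpleRoots d a r₁ r₂) :
    TwoSimpleRoots d a r₂ r₁ :=
  ⟨h.1.symm, h.2.2.1, h.2.1, h.2.2.2.2.1, h.2.2.2.1, fun x hx => (h.2.2.2.2.2 x hx).symm⟩

theorem TwoSimpleRoots.mem_rootFiber {d : ℕ} (hd : 0 < d) {ε a : Fin d → ℝ}
    (hε0 : ε ⟨0, hd⟩ = -1) (hsign : ∀ j, 0 < ε j * a j) {r₁ r₂ : ℝ} (hlt : r₁ < r₂)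
    (h : TwoSimpleRoots d a r₁ r₂) : r₁ < 0 ∧ 0 < r₂ ∧ a ∈ rootFiber d ε (-r₁, r₂) := by
  obtain ⟨-, h₁, h₂, h₁', h₂', huniq⟩ := h
  obtain ⟨W, hW⟩ := exists_eq_mul_of_roots (P := Qpoly d a) (s := -r₁) (t := r₂)
    (by linarith) h₂ (by simpa using h₁)
  have hev : ∀ x, (Qpoly d a).eval x = (x - r₂) * (x - r₁) * W.eval x := fun x => by
    simp [hW, sub_eq_add_neg]
  have hne : ∀ x, W.eval x ≠ 0 := by
    intro x hx
    rcases huniq x (by rw [hev, hx, mul_zero]) with rfl | rfl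
    · refine h₁' ?_
      have := eval_derivative_right (-x) r₂ W
      rw [← hW, neg_neg, hx] at this
      simpa using this
    · refine h₂' ?_
      have := eval_derivative_left (-r₁) x W
      rw [← hW, hx] at this
      simpa using this
  have htop : Tendsto (fun x => (Qpoly d a).eval x) atTop atTop :=
    tendsto_atTop_of_leadingCoeff_nonneg _
      (natDegree_pos_iff_degree_pos.1 (by rwa [natDegree_Qpoly]))
      (by rw [(monic_Qpoly d a).leadingCoeff]; exact zero_le_one)
  obtain ⟨y, hy, hyr⟩ := ((htop.eventually_gt_atTop 0).and (eventually_gt_atTop r₂)).exists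
  have hWy : 0 < W.eval y := by
    rw [hev] at hy
    exact pos_of_mul_pos_right hy
      (mul_pos (sub_pos.2 hyr) (sub_pos.2 (hlt.trans hyr))).le
  have hWpos : ∀ x, 0 < W.eval x := by
    intro x
    by_contra! hx
    obtain ⟨z, hz⟩ := mem_range_of_exists_le_of_exists_ge W.continuous ⟨x, hx⟩ ⟨y, hWy.le⟩
    exact hne z hz
  have h0 : (Qpoly d a).eval 0 < 0 := by
    rw [← coeff_zero_eq_eval_zero, coeff_Qpoly d a ⟨0, hd⟩]
    have := hsign ⟨0, hd⟩
    rw [hε0] at this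
    linarith
  have hprod : r₂ * r₁ < 0 := by
    rw [hev] at h0
    by_contra! hr
    have := mul_nonneg hr (hWpos 0).le
    linarith
  have hr : r₁ < 0 ∧ 0 < r₂ := by
    rcases mul_neg_iff.1 hprod with h | h
    · exact ⟨h.2, h.1⟩
    · linarith
  exact ⟨hr.1, hr.2, hsign, W, hW, hWpos⟩

theorem stmt2 (d : ℕ) (hd : 0 < d) (hdeven : Even d)
    (ε : Fin d → ℝ) (hε : ∀ j, ε j = 1 ∨ ε j = -1)
    (hε0 : ε ⟨0, hd⟩ = -1) :
    let G : Set (Fin d → ℝ) :=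
      {a | (∀ j : Fin d, 0 < ε j * a j) ∧ ∃ r₁ r₂ : ℝ, TwoSimpleRoots d a r₁ r₂}
    ContractibleSpace G := by
  intro G
  have hG : ∀ a ∈ G, ∃ b : ℝ × ℝ, 0 < b.1 ∧ 0 < b.2 ∧ a ∈ rootFiber d ε b := by
    rintro a ⟨hsign, r₁, r₂, h⟩
    rcases h.1.lt_or_gt with hlt | hlt
    · obtain ⟨h₁, h₂, hf⟩ := h.mem_rootFiber hd hε0 hsign hlt
      exact ⟨_, neg_pos.2 h₁, h₂, hf⟩
    · obtain ⟨h₁, h₂, hf⟩ := h.symm.mem_rootFiber hd hε0 hsign hlt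
      exact ⟨_, neg_pos.2 h₁, h₂, hf⟩
  choose! π hπ₁ hπ₂ hπ using hG
  have hsub : ∀ b ∈ {b : ℝ × ℝ | 0 < b.1 ∧ 0 < b.2 ∧ (rootFiber d ε b).Nonempty},
      rootFiber d ε b ⊆ G := fun b hb a ha =>
    ⟨ha.1, _, _, twoSimpleRoots_of_mem_rootFiber ha hb.1 hb.2.1⟩
  refine contractibleSpace_of_convex_fibers (rootFiber d ε) π
    (convex_setOf_rootFiber_nonempty hd hdeven hε hε0)
    (exists_rootFiber_nonempty hd hdeven hε hε0)
    (continuousOn_roots fun a ha => ⟨hπ₁ a ha, hπ₂ a ha, hπ a ha⟩)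
    (fun a ha => ⟨hπ₁ a ha, hπ₂ a ha, a, hπ a ha⟩) hπ hsub (fun b hb a ha => ?_)
    (convex_rootFiber d ε) fun b hb => ?_
  · have haG := hsub b hb ha
    exact rootFiber_unique (hπ a haG) ha (hπ₁ a haG) (hπ₂ a haG) hb.1 hb.2.1
  · obtain ⟨g, hg, hgm⟩ := exists_local_selection hb.2.2
    exact ⟨g, hg, hgm.mono fun c hc _ => hc⟩
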